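/- Existence and uniqueness for the discrete Poisson problem: for every v_h ∈ P₀ and every c ∈ ℝ there exists a unique q_h ∈ P₁^{nc} ∩ L²₀ such that div_h(∇_h q_h) = c · div_h v_h (an equality of elements of P₁^{nc}). In particular, the only q_h ∈ P₁^{nc} ∩ L²₀ with div_h(∇_h q_h) = 0 is q_h = 0. -/

import Mathlib

open scoped RealInnerProductSpace
open MeasureTheory

attribute [local instance] Classical.propDecidable

noncomputable section

/-- The Euclidean plane. -/
abbrev E2 : Type := EuclideanSpace ℝ (Fin 2)

/-- A nondegenerate (closed) triangle of the plane, given by its three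
affinely independent vertices. -/
structure Tri : Type where
  vtx : Fin 3 → E2
  indep : AffineIndependent ℝ vtx

namespace Tri

/-- The triangle as a subset of the plane: the convex hull of its vertices. -/
def carrier (t : Tri) : Set E2 := convexHull ℝ (Set.range t.vtx)

/-- The area `|K|` of the triangle. -/
def area (t : Tri) : ℝ := (volume t.carrier).toReal

/-- The centroid of the triangle. -/
def centroid (t : Tri) : E2 := Finset.centroid ℝ Finset.univ t.vtx

/-- The triangle seen as a 2-simplex. -/
def simplex (t : Tri) : Affine.Simplex ℝ E2 2 := ⟨t.vtx, t.indep⟩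

/-- The circumcenter `x_K` of the triangle. -/
def ccenter (t : Tri) : E2 := t.simplex.circumcenter

/-- `σ` (an ordered pair of distinct points) is an edge of the triangle `t`:
both of its endpoints are vertices of `t`. -/
def hasEdge (t : Tri) (σ : E2 × E2) : Prop :=
  σ.1 ≠ σ.2 ∧ σ.1 ∈ Set.range t.vtx ∧ σ.2 ∈ Set.range t.vtx

end Tri

/-- The segment of an edge. -/
def eseg (σ : E2 × E2) : Set E2 := segment ℝ σ.1 σ.2

/-- The length `|σ|` of an edge. -/
def elen (σ : E2 × E2) : ℝ := dist σ.1 σ.2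

/-- The midpoint `x_σ` of an edge. -/
def emid (σ : E2 × E2) : E2 := midpoint ℝ σ.1 σ.2

/-- Rotation by `π/2` in the plane. -/
def perp (x : E2) : E2 := (EuclideanSpace.equiv (Fin 2) ℝ).symm ![-(x 1), x 0]

/-- The unit normal `n_{K,σ}` to the edge `σ`, pointing outward of the triangle `t`. -/
def Tri.nrm (t : Tri) (σ : E2 × E2) : E2 :=
  if 0 ≤ ⟪perp (σ.2 - σ.1), emid σ - t.centroid⟫
  then (elen σ)⁻¹ • perp (σ.2 - σ.1)
  else -((elen σ)⁻¹ • perp (σ.2 - σ.1))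

/-- An admissible triangulation `𝒯_h` of `Ω`, together with a registration of its
edges (each geometric edge is recorded once, with a chosen orientation) and a labelling
`K_σ`, `L_σ` of the triangle(s) adjacent to each edge.  All interior angles of all
triangles are `< π/2`. -/
structure Mesh (Ω : Set E2) : Type where
  tris : Finset Tri
  tris_nonempty : tris.Nonempty
  edges : Finset (E2 × E2)
  Kof : E2 × E2 → Tri
  Lof : E2 × E2 → Tri
  interior_disjoint : ∀ t₁ ∈ tris, ∀ t₂ ∈ tris, t₁ ≠ t₂ →
    interior t₁.carrier ∩ interior t₂.carrier = ∅
  union_eq : ⋃ t ∈ (tris : Set Tri), t.carrier = closure Ω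
  inter_structure : ∀ t₁ ∈ tris, ∀ t₂ ∈ tris, t₁ ≠ t₂ →
    t₁.carrier ∩ t₂.carrier = ∅
    ∨ (∃ a ∈ Set.range t₁.vtx ∩ Set.range t₂.vtx, t₁.carrier ∩ t₂.carrier = {a})
    ∨ (∃ σ, t₁.hasEdge σ ∧ t₂.hasEdge σ ∧ t₁.carrier ∩ t₂.carrier = eseg σ)
  angles_lt : ∀ t ∈ tris, ∀ i j l : Fin 3, i ≠ j → i ≠ l → j ≠ l →
    EuclideanGeometry.angle (t.vtx j) (t.vtx i) (t.vtx l) < Real.pi / 2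
  edges_ne : ∀ σ ∈ edges, σ.1 ≠ σ.2
  edges_cover : ∀ t ∈ tris, ∀ i j : Fin 3, i ≠ j →
    (t.vtx i, t.vtx j) ∈ edges ∨ (t.vtx j, t.vtx i) ∈ edges
  edges_sub : ∀ σ ∈ edges, ∃ t ∈ tris, t.hasEdge σ
  edges_orient : ∀ σ ∈ edges, Prod.swap σ ∉ edges
  edges_atMostTwo : ∀ σ ∈ edges, (tris.filter fun t => t.hasEdge σ).card ≤ 2
  Kof_mem : ∀ σ ∈ edges, Kof σ ∈ tris ∧ (Kof σ).hasEdge σ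
  Lof_mem : ∀ σ ∈ edges, (tris.filter fun t => t.hasEdge σ).card = 2 →
    Lof σ ∈ tris ∧ (Lof σ).hasEdge σ ∧ Lof σ ≠ Kof σ
  ext_frontier : ∀ σ ∈ edges, (tris.filter fun t => t.hasEdge σ).card = 1 →
    eseg σ ⊆ frontier Ω

namespace Mesh

variable {Ω : Set E2} (M : Mesh Ω)

/-- The interior edges `ℰ_h^int` (shared by exactly two triangles). -/
def intEdges : Finset (E2 × E2) :=
  M.edges.filter fun σ => (M.tris.filter fun t => t.hasEdge σ).card = 2

/-- The boundary edges `ℰ_h^ext`. -/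
def extEdges : Finset (E2 × E2) :=
  M.edges.filter fun σ => (M.tris.filter fun t => t.hasEdge σ).card = 1

/-- `d_σ`: distance between the circumcenters of the two triangles sharing `σ`
(interior edges), or from the circumcenter of `K_σ` to the midpoint of `σ`
(boundary edges). -/
def dOf (σ : E2 × E2) : ℝ :=
  if (M.tris.filter fun t => t.hasEdge σ).card = 2
  then dist (M.Kof σ).ccenter (M.Lof σ).ccenter
  else dist (M.Kof σ).ccenter (emid σ)

/-- `τ_σ = |σ| / d_σ`. -/
def tau (σ : E2 × E2) : ℝ := elen σ / M.dOf σ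

/-- The mesh size `h`: the largest diameter of a circumscribed circle. -/
def meshSize : ℝ := M.tris.sup' M.tris_nonempty fun t => 2 * t.simplex.circumradius

/-- Mesh regularity with constant `C_reg`: `d_σ ≥ C_reg |σ|` and `|σ| ≥ C_reg h`. -/
def Regular (Creg : ℝ) : Prop :=
  ∀ σ ∈ M.edges, Creg * elen σ ≤ M.dOf σ ∧ Creg * M.meshSize ≤ elen σ

/-- For `σ` an edge of `t`, the triangle on the other side of `σ`. -/
def other (t : Tri) (σ : E2 × E2) : Tri := if M.Kof σ = t then M.Lof σ else M.Kof σ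

/-- The `L²(Ω)` inner product of two piecewise constant (`P₀`) fields. -/
def l2P0 (v w : Tri → E2) : ℝ := ∑ t ∈ M.tris, t.area * ⟪v t, w t⟫

/-- The `L²(Ω)` norm of a `P₀` field. -/
def l2normP0 (v : Tri → E2) : ℝ := Real.sqrt (M.l2P0 v v)

/-- The discrete `H¹` norm `‖·‖_h` on `P₀`. -/
def normh (v : Tri → E2) : ℝ :=
  Real.sqrt (∑ σ ∈ M.intEdges, M.tau σ * ‖v (M.Lof σ) - v (M.Kof σ)‖ ^ 2
    + ∑ σ ∈ M.extEdges, M.tau σ * ‖v (M.Kof σ)‖ ^ 2)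

/-- A family of affine maps (one per triangle) is in `P₁^{nc}`: the two traces agree
at the midpoint of every interior edge. -/
def IsP1nc (q : Tri → (E2 →ᵃ[ℝ] ℝ)) : Prop :=
  ∀ σ ∈ M.intEdges, q (M.Kof σ) (emid σ) = q (M.Lof σ) (emid σ)

/-- Membership in `L²₀`: the piecewise affine function has zero mean on `Ω`. -/
def MeanZero (q : Tri → (E2 →ᵃ[ℝ] ℝ)) : Prop :=
  ∑ t ∈ M.tris, ∫ x in t.carrier, q t x = 0

/-- The `L²(Ω)` inner product of two piecewise affine functions. -/
def l2P1 (q r : Tri → (E2 →ᵃ[ℝ] ℝ)) : ℝ :=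
  ∑ t ∈ M.tris, ∫ x in t.carrier, q t x * r t x

/-- The `L²(Ω)` norm of a piecewise affine function. -/
def l2normP1 (q : Tri → (E2 →ᵃ[ℝ] ℝ)) : ℝ := Real.sqrt (M.l2P1 q q)

end Mesh

/-- The gradient (a constant vector) of an affine function on the plane. -/
def gradA (f : E2 →ᵃ[ℝ] ℝ) : E2 :=
  (InnerProductSpace.toDual ℝ E2).symm (LinearMap.toContinuousLinearMap f.linear)

/-- The discrete gradient `∇_h q` of a piecewise affine function: the piecewise
constant field equal on each triangle to the gradient of the affine piece. -/
def gradh (q : Tri → (E2 →ᵃ[ℝ] ℝ)) : Tri → E2 := fun t => gradA (q t)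

/-- The (constant) divergence of an affine vector field of the plane. -/
def divA (f : E2 →ᵃ[ℝ] E2) : ℝ := LinearMap.trace ℝ E2 f.linear

/-- The normal component `(u·n_{K,σ})_σ` of a piecewise affine field on the edge `σ`
of the triangle `t` (evaluated at the midpoint of `σ`). -/
def unrm (u : Tri → (E2 →ᵃ[ℝ] E2)) (t : Tri) (σ : E2 × E2) : ℝ :=
  ⟪u t (emid σ), t.nrm σ⟫

namespace Mesh

variable {Ω : Set E2} (M : Mesh Ω)

/-- The norm `‖q‖_{1,h} = (|q|² + |∇_h q|²)^{1/2}` on `P₁^{nc}`. -/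
def norm1h (q : Tri → (E2 →ᵃ[ℝ] ℝ)) : ℝ :=
  Real.sqrt ((M.l2normP1 q) ^ 2 + (M.l2normP0 (gradh q)) ^ 2)

/-- The prescribed value of `div_h v` at the midpoint of the edge `σ`. -/
def divhImage (v : Tri → E2) (σ : E2 × E2) : ℝ :=
  if (M.tris.filter fun t => t.hasEdge σ).card = 2 then
    (3 * elen σ / ((M.Kof σ).area + (M.Lof σ).area)) *
      ⟪v (M.Lof σ) - v (M.Kof σ), (M.Kof σ).nrm σ⟫
  else
    -((3 * elen σ / (M.Kof σ).area) * ⟪v (M.Kof σ), (M.Kof σ).nrm σ⟫)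

/-- `d = div_h v`: `d` is the element of `P₁^{nc}` taking the prescribed values at
the midpoints of the edges. -/
def IsDivh (v : Tri → E2) (d : Tri → (E2 →ᵃ[ℝ] ℝ)) : Prop :=
  M.IsP1nc d ∧
    ∀ t ∈ M.tris, ∀ σ ∈ M.edges, t.hasEdge σ → d t (emid σ) = M.divhImage v σ

/-- The discrete Laplacian `Δ̃_h` on `P₀`. -/
def laph (v : Tri → E2) : Tri → E2 := fun t =>
  (t.area)⁻¹ •
    ((∑ σ ∈ M.intEdges.filter fun σ => t.hasEdge σ, M.tau σ • (v (M.other t σ) - v t))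
      - ∑ σ ∈ M.extEdges.filter fun σ => t.hasEdge σ, M.tau σ • v t)

/-- The upwind convection operator `b̃_h(u_h, v_h) ∈ P₀`. -/
def btilde (u : Tri → (E2 →ᵃ[ℝ] E2)) (v : Tri → E2) : Tri → E2 := fun t =>
  (t.area)⁻¹ • ∑ σ ∈ M.intEdges.filter fun σ => t.hasEdge σ,
    elen σ • (max (unrm u t σ) 0 • v t + min (unrm u t σ) 0 • v (M.other t σ))

/-- The trilinear form `b_h(u_h, v_h, w_h)`. -/
def bh (u : Tri → (E2 →ᵃ[ℝ] E2)) (v w : Tri → E2) : ℝ :=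
  ∑ t ∈ M.tris, t.area * ⟪w t, M.btilde u v t⟫

/-- Membership in the lowest-order Raviart–Thomas space `RT₀`: the normal component is
constant on each edge of each triangle, matches across interior edges and vanishes on
boundary edges. -/
def IsRT0 (u : Tri → (E2 →ᵃ[ℝ] E2)) : Prop :=
  (∀ t ∈ M.tris, ∀ σ ∈ M.edges, t.hasEdge σ → ∀ x ∈ eseg σ,
      ⟪u t x, t.nrm σ⟫ = unrm u t σ)
  ∧ (∀ σ ∈ M.intEdges,
      ⟪u (M.Kof σ) (emid σ), (M.Kof σ).nrm σ⟫ =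
        ⟪u (M.Lof σ) (emid σ), (M.Kof σ).nrm σ⟫)
  ∧ (∀ σ ∈ M.extEdges, unrm u (M.Kof σ) σ = 0)

/-- Membership of a piecewise constant field in `P₀ ∩ RT₀`. -/
def IsRT0const (v : Tri → E2) : Prop :=
  (∀ σ ∈ M.intEdges, ⟪v (M.Lof σ) - v (M.Kof σ), (M.Kof σ).nrm σ⟫ = 0)
  ∧ ∀ σ ∈ M.extEdges, ⟪v (M.Kof σ), (M.Kof σ).nrm σ⟫ = 0

/-- The `L²(Ω)` norm of a piecewise affine vector field. -/
def l2normRT (u : Tri → (E2 →ᵃ[ℝ] E2)) : ℝ :=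
  Real.sqrt (∑ t ∈ M.tris, ∫ x in t.carrier, ‖u t x‖ ^ 2)

end Mesh

/-- Removing a countable set from an open preconnected set of a real inner product space of
dimension `> 1` leaves a preconnected set. -/
theorem IsOpen.isPreconnected_diff_countable {E : Type*} [NormedAddCommGroup E]
    [InnerProductSpace ℝ E] (hE : 1 < Module.rank ℝ E) {U F : Set E} (hU : IsOpen U)
    (hUc : IsPreconnected U) (hF : F.Countable) : IsPreconnected (U \ F) := by
  have hnt : Nontrivial E := rank_pos_iff_nontrivial.1 (zero_lt_one.trans hE)
  have hdense : Dense Fᶜ := hF.dense_compl ℝ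
  have hball : ∀ (x : E) (r : ℝ), 0 < r → IsPreconnected (Metric.ball x r \ F) := by
    intro x r hr
    let φ := OpenPartialHomeomorph.univBall x r
    have hsrc : φ.source = Set.univ := OpenPartialHomeomorph.univBall_source x r
    have htgt : φ.target = Metric.ball x r := OpenPartialHomeomorph.univBall_target x hr
    have hinj : Function.Injective φ := by
      rw [← Set.injOn_univ, ← hsrc]
      exact φ.injOn
    have hrange : Set.range φ = Metric.ball x r := by
      rw [← Set.image_univ, ← hsrc, φ.image_source_eq_target, htgt]
    have hconn := ((hF.preimage hinj).isConnected_compl_of_one_lt_rank hE).isPreconnected.image φ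
      (OpenPartialHomeomorph.continuous_univBall x r).continuousOn
    rwa [← Set.preimage_compl, Set.image_preimage_eq_inter_range, hrange, Set.inter_comm] at hconn
  intro u v hu hv huv hUu hUv
  by_contra hempty
  rw [Set.not_nonempty_iff_eq_empty] at hempty
  let G : Set E → Set E := fun w => {x | ∃ V : Set E, IsOpen V ∧ x ∈ V ∧ V \ F ⊆ w}
  have hGopen : ∀ w, IsOpen (G w) := by
    refine fun w => isOpen_iff_forall_mem_open.2 ?_
    rintro x ⟨V, hV, hxV, hVw⟩
    exact ⟨V, fun y hy => ⟨V, hV, hy, hVw⟩, hV, hxV⟩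
  have hGself : ∀ w, IsOpen w → w ⊆ G w := fun w hw x hx => ⟨w, hw, hx, Set.sdiff_subset⟩
  have hcover : U ⊆ G u ∪ G v := by
    intro x hx
    obtain ⟨r, hr, hrU⟩ := Metric.isOpen_iff.1 hU x hx
    have hsub : Metric.ball x r \ F ⊆ U \ F := Set.sdiff_subset_sdiff_left hrU
    rcases isPreconnected_iff_subset_of_disjoint.1 (hball x r hr) u v hu hv (hsub.trans huv)
      (Set.subset_eq_empty (Set.inter_subset_inter_left _ hsub) hempty) with h | h
    · exact Or.inl ⟨_, Metric.isOpen_ball, Metric.mem_ball_self hr, h⟩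
    · exact Or.inr ⟨_, Metric.isOpen_ball, Metric.mem_ball_self hr, h⟩
  obtain ⟨x, hxU, ⟨V, hV, hxV, hVu⟩, ⟨W, hW, hxW, hWv⟩⟩ := hUc _ _ (hGopen u) (hGopen v) hcover
    (hUu.mono (Set.inter_subset_inter Set.sdiff_subset (hGself u hu)))
    (hUv.mono (Set.inter_subset_inter Set.sdiff_subset (hGself v hv)))
  obtain ⟨y, ⟨⟨hyU, hyV⟩, hyW⟩, hyF⟩ :=
    hdense.inter_open_nonempty _ ((hU.inter hV).inter hW) ⟨x, ⟨hxU, hxV⟩, hxW⟩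
  exact Set.eq_empty_iff_forall_notMem.1 hempty y ⟨⟨hyU, hyF⟩, hVu ⟨hyV, hyF⟩, hWv ⟨hyW, hyF⟩⟩

theorem inner_gradA (f : E2 →ᵃ[ℝ] ℝ) (x : E2) : ⟪gradA f, x⟫ = f.linear x := by
  simp [gradA]

/-- The gradient as a linear map on affine functions. -/
def gradAₗ : (E2 →ᵃ[ℝ] ℝ) →ₗ[ℝ] E2 where
  toFun := gradA
  map_add' f g := ext_inner_right ℝ fun x => by simp [inner_add_left, inner_gradA]
  map_smul' a f := ext_inner_right ℝ fun x => by simp [inner_smul_left, inner_gradA]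

theorem gradA_sub (f g : E2 →ᵃ[ℝ] ℝ) : gradA (f - g) = gradA f - gradA g :=
  gradAₗ.map_sub f g

theorem apply_eq_add_inner_gradA (f : E2 →ᵃ[ℝ] ℝ) (x y : E2) :
    f x = f y + ⟪gradA f, x - y⟫ := by
  rw [inner_gradA, ← vsub_eq_sub, AffineMap.linearMap_vsub]
  simp

theorem gradA_const (k : ℝ) : gradA (AffineMap.const ℝ E2 k) = 0 :=
  ext_inner_right ℝ fun x => by simp [inner_gradA]

theorem perp_ne_zero {x : E2} (hx : x ≠ 0) : perp x ≠ 0 := by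
  contrapose! hx
  have h0 := congrArg (fun y : E2 => y 0) hx
  have h1 := congrArg (fun y : E2 => y 1) hx
  ext i
  fin_cases i <;> simp_all [perp]

theorem perp_neg (x : E2) : perp (-x) = -perp x := by
  ext i
  fin_cases i <;> simp [perp]

theorem emid_swap (σ : E2 × E2) : emid σ.swap = emid σ := midpoint_comm _ _

theorem affineMap_emid (f : E2 →ᵃ[ℝ] ℝ) (σ : E2 × E2) : f (emid σ) = (f σ.1 + f σ.2) / 2 := by
  rw [emid, AffineMap.map_midpoint, midpoint_eq_smul_add]
  simp
  ring

theorem Fin.sum_univ_three_of_ne {i j k : Fin 3} (hij : i ≠ j) (hik : i ≠ k) (hjk : j ≠ k)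
    (F : Fin 3 → ℝ) : ∑ l, F l = F i + F j + F k := by
  have huniv : (Finset.univ : Finset (Fin 3)) = {i, j, k} := by
    ext l
    simp only [Finset.mem_univ, Finset.mem_insert, Finset.mem_singleton, true_iff]
    omega
  rw [huniv, Finset.sum_insert (by simp [hij, hik]), Finset.sum_insert (by simp [hjk]),
    Finset.sum_singleton, add_assoc]

/-- The signed distance to the line through the edge `σ`, scaled by `|σ|`. -/
def edgeFn (σ : E2 × E2) (x : E2) : ℝ := ⟪perp (σ.2 - σ.1), emid σ - x⟫

namespace Tri

/-- The vertices of a triangle as an affine basis of the plane. -/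
def affBasis (t : Tri) : AffineBasis (Fin 3) ℝ E2 :=
  ⟨t.vtx, t.indep, t.indep.affineSpan_eq_top_iff_card_eq_finrank_add_one.2 (by simp)⟩

theorem affBasis_apply (t : Tri) (i : Fin 3) : t.affBasis i = t.vtx i := rfl

theorem vtx_injective (t : Tri) : Function.Injective t.vtx := t.indep.injective

theorem exists_affineMap_vtx_eq (t : Tri) (y : Fin 3 → ℝ) :
    ∃ f : E2 →ᵃ[ℝ] ℝ, ∀ i, f (t.vtx i) = y i := by
  refine ⟨∑ i, y i • t.affBasis.coord i, fun i => ?_⟩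
  have happ : ∀ x, (∑ j, y j • t.affBasis.coord j : E2 →ᵃ[ℝ] ℝ) x
      = ∑ j, y j * t.affBasis.coord j x := fun x => by
    simp [Fin.sum_univ_three]
  rw [happ, ← t.affBasis_apply]
  simp [AffineBasis.coord_apply]

theorem isCompact_carrier (t : Tri) : IsCompact t.carrier :=
  (Set.finite_range t.vtx).isCompact_convexHull ℝ

theorem centroid_mem_interior (t : Tri) : t.centroid ∈ interior t.carrier :=
  t.affBasis.centroid_mem_interior_convexHull

theorem area_pos (t : Tri) : 0 < t.area :=
  ENNReal.toReal_pos
    (isOpen_interior.measure_pos volume ⟨_, t.centroid_mem_interior⟩ |>.trans_le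
      (measure_mono interior_subset)).ne'
    t.isCompact_carrier.measure_lt_top.ne

theorem mem_interior_carrier_iff (t : Tri) (x : E2) :
    x ∈ interior t.carrier ↔ ∀ i, 0 < t.affBasis.coord i x := by
  have := t.affBasis.interior_convexHull
  change x ∈ interior (convexHull ℝ (Set.range t.affBasis)) ↔ _
  rw [this]
  rfl

theorem integrableOn_affineMap (t : Tri) (f : E2 →ᵃ[ℝ] ℝ) : IntegrableOn f t.carrier :=
  f.continuous_of_finiteDimensional.continuousOn.integrableOn_compact t.isCompact_carrier

theorem setIntegral_const (t : Tri) (k : ℝ) : ∫ _ in t.carrier, k = t.area * k := by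
  simp [area, Measure.real]

theorem hasEdge_swap (t : Tri) (σ : E2 × E2) : t.hasEdge σ.swap ↔ t.hasEdge σ := by
  simp only [hasEdge, Prod.fst_swap, Prod.snd_swap, ne_comm, and_comm]

theorem hasEdge.exists_vtx {t : Tri} {σ : E2 × E2} (h : t.hasEdge σ) :
    ∃ i j k : Fin 3, i ≠ j ∧ i ≠ k ∧ j ≠ k ∧ σ = (t.vtx i, t.vtx j) := by
  obtain ⟨hne, ⟨i, hi⟩, ⟨j, hj⟩⟩ := h
  have hij : i ≠ j := fun hij => hne (by rw [← hi, ← hj, hij])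
  obtain ⟨k, hk⟩ : ∃ k : Fin 3, i ≠ k ∧ j ≠ k :=
    ⟨⟨3 - i - j, by omega⟩, by simp only [ne_eq, Fin.ext_iff]; omega,
      by simp only [ne_eq, Fin.ext_iff]; omega⟩
  exact ⟨i, j, k, hij, hk.1, hk.2, Prod.ext hi.symm hj.symm⟩

theorem edgeFn_eq_coord_mul (t : Tri) {i j k : Fin 3} (hij : i ≠ j) (hik : i ≠ k) (hjk : j ≠ k)
    (x : E2) : edgeFn (t.vtx i, t.vtx j) x
      = t.affBasis.coord k x * edgeFn (t.vtx i, t.vtx j) (t.vtx k) := by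
  have hsum := t.affBasis.sum_coord_apply_eq_one x
  rw [Fin.sum_univ_three_of_ne hij hik hjk] at hsum
  have hx : ∀ m, x m = t.affBasis.coord i x * t.vtx i m + t.affBasis.coord j x * t.vtx j m
      + t.affBasis.coord k x * t.vtx k m := by
    intro m
    rw [← Fin.sum_univ_three_of_ne hij hik hjk fun l => t.affBasis.coord l x * t.vtx l m]
    conv_lhs => rw [← t.affBasis.linear_combination_coord_eq_self x]
    simp [affBasis_apply]
  set a := t.affBasis.coord i x
  set b := t.affBasis.coord j x
  set c := t.affBasis.coord k x
  have ha : a = 1 - b - c := by linarith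
  simp [edgeFn, perp, emid, midpoint_eq_smul_add, PiLp.inner_apply, Fin.sum_univ_two, hx, ha]
  ring

theorem edgeFn_vtx_ne_zero (t : Tri) {i j k : Fin 3} (hij : i ≠ j) (hik : i ≠ k) (hjk : j ≠ k) :
    edgeFn (t.vtx i, t.vtx j) (t.vtx k) ≠ 0 := by
  intro h
  have := t.edgeFn_eq_coord_mul hij hik hjk
    (emid (t.vtx i, t.vtx j) - perp (t.vtx j - t.vtx i))
  rw [h, mul_zero, edgeFn, sub_sub_cancel, inner_self_eq_zero] at this
  exact perp_ne_zero (sub_ne_zero.2 fun h => hij (t.vtx_injective h.symm)) this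

theorem edgeFn_centroid (t : Tri) {i j k : Fin 3} (hij : i ≠ j) (hik : i ≠ k) (hjk : j ≠ k) :
    edgeFn (t.vtx i, t.vtx j) t.centroid = edgeFn (t.vtx i, t.vtx j) (t.vtx k) / 3 := by
  rw [t.edgeFn_eq_coord_mul hij hik hjk]
  have : t.affBasis.coord k t.centroid = (3 : ℝ)⁻¹ := by
    refine (t.affBasis.coord_apply_centroid (s := Finset.univ) (Finset.mem_univ k)).trans ?_
    simp
  rw [this]
  ring

theorem hasEdge.edgeFn_centroid_ne_zero {t : Tri} {σ : E2 × E2} (h : t.hasEdge σ) :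
    edgeFn σ t.centroid ≠ 0 := by
  obtain ⟨i, j, k, hij, hik, hjk, rfl⟩ := h.exists_vtx
  rw [t.edgeFn_centroid hij hik hjk]
  exact div_ne_zero (t.edgeFn_vtx_ne_zero hij hik hjk) three_ne_zero

/-- Points close to the midpoint of an edge, on the same side of it as the triangle, lie in the
interior of the triangle. -/
theorem hasEdge.eventually_lineMap_mem_interior {t : Tri} {σ : E2 × E2} (h : t.hasEdge σ) {x : E2}
    (hx : 0 < edgeFn σ t.centroid * edgeFn σ x) :
    ∀ᶠ s : ℝ in nhdsWithin 0 (Set.Ioi 0),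
      AffineMap.lineMap (emid σ) x s ∈ interior t.carrier := by
  obtain ⟨i, j, k, hij, hik, hjk, rfl⟩ := h.exists_vtx
  have hcoord : ∀ l, t.affBasis.coord l (emid (t.vtx i, t.vtx j))
      = (t.affBasis.coord l (t.vtx i) + t.affBasis.coord l (t.vtx j)) / 2 := fun l =>
    affineMap_emid _ _
  have hk : 0 < t.affBasis.coord k x := by
    rw [t.edgeFn_centroid hij hik hjk, t.edgeFn_eq_coord_mul hij hik hjk x] at hx
    have := sq_nonneg (edgeFn (t.vtx i, t.vtx j) (t.vtx k))
    by_contra! hneg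
    nlinarith [mul_nonneg (neg_nonneg.2 hneg) this]
  have hmid : ∀ l, l ≠ k → 0 < t.affBasis.coord l (emid (t.vtx i, t.vtx j)) := by
    intro l hl
    rw [hcoord, ← t.affBasis_apply, ← t.affBasis_apply, AffineBasis.coord_apply,
      AffineBasis.coord_apply]
    have : l = i ∨ l = j := by omega
    rcases this with rfl | rfl <;> simp [hij, hij.symm]
  have hmidk : t.affBasis.coord k (emid (t.vtx i, t.vtx j)) = 0 := by
    rw [hcoord, ← t.affBasis_apply, ← t.affBasis_apply, AffineBasis.coord_apply,
      AffineBasis.coord_apply]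
    simp [hik.symm, hjk.symm]
  simp only [mem_interior_carrier_iff]
  rw [Filter.eventually_all]
  intro l
  by_cases hl : l = k
  · subst hl
    filter_upwards [self_mem_nhdsWithin] with s hs
    rw [AffineMap.apply_lineMap, hmidk, AffineMap.lineMap_apply_module]
    simpa using mul_pos hs hk
  · have hcont : Continuous fun s : ℝ =>
        t.affBasis.coord l (AffineMap.lineMap (emid (t.vtx i, t.vtx j)) x s) :=
      (t.affBasis.coord l).continuous_of_finiteDimensional.comp AffineMap.lineMap_continuous
    refine nhdsWithin_le_nhds (hcont.continuousAt.eventually_const_lt ?_)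
    simpa using hmid l hl

theorem hasEdge.edgeFn_mul_neg {t₁ t₂ : Tri} {σ : E2 × E2} (h₁ : t₁.hasEdge σ) (h₂ : t₂.hasEdge σ)
    (hdisj : interior t₁.carrier ∩ interior t₂.carrier = ∅) :
    edgeFn σ t₁.centroid * edgeFn σ t₂.centroid < 0 := by
  by_contra! hge
  have hne := mul_ne_zero h₁.edgeFn_centroid_ne_zero h₂.edgeFn_centroid_ne_zero
  have hpos := lt_of_le_of_ne hge hne.symm
  obtain ⟨s, hs₁, hs₂⟩ := ((h₁.eventually_lineMap_mem_interior hpos).and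
    (h₂.eventually_lineMap_mem_interior (mul_self_pos.2 h₂.edgeFn_centroid_ne_zero))).exists
  exact Set.eq_empty_iff_forall_notMem.1 hdisj _ ⟨hs₁, hs₂⟩

/-- The outward normal to the edge `σ` of the triangle, of length `|σ|`. -/
def scaledNrm (t : Tri) (σ : E2 × E2) : E2 :=
  Real.sign (edgeFn σ t.centroid) • perp (σ.2 - σ.1)

theorem hasEdge.elen_smul_nrm {t : Tri} {σ : E2 × E2} (h : t.hasEdge σ) :
    elen σ • t.nrm σ = t.scaledNrm σ := by
  have hlen : elen σ ≠ 0 := dist_ne_zero.2 h.1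
  have hne := h.edgeFn_centroid_ne_zero
  rw [nrm, scaledNrm]
  change _ • (if 0 ≤ edgeFn σ t.centroid then _ else _) = _
  split_ifs with hs
  · rw [Real.sign_of_pos (lt_of_le_of_ne hs hne.symm), smul_inv_smul₀ hlen, one_smul]
  · rw [Real.sign_of_neg (not_le.1 hs), smul_neg, smul_inv_smul₀ hlen, neg_one_smul]

theorem scaledNrm_swap (t : Tri) (σ : E2 × E2) : t.scaledNrm σ.swap = t.scaledNrm σ := by
  have hperp : perp (σ.1 - σ.2) = -perp (σ.2 - σ.1) := by rw [← perp_neg, neg_sub]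
  have hfn : edgeFn σ.swap t.centroid = -edgeFn σ t.centroid := by
    rw [edgeFn, emid_swap, edgeFn, Prod.fst_swap, Prod.snd_swap, hperp, inner_neg_left]
  rw [scaledNrm, hfn, Real.sign_neg, Prod.fst_swap, Prod.snd_swap, hperp, neg_smul_neg, scaledNrm]

theorem hasEdge.scaledNrm_eq_neg {t₁ t₂ : Tri} {σ : E2 × E2} (h₁ : t₁.hasEdge σ)
    (h₂ : t₂.hasEdge σ) (hdisj : interior t₁.carrier ∩ interior t₂.carrier = ∅) :
    t₂.scaledNrm σ = -t₁.scaledNrm σ := by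
  rw [scaledNrm, scaledNrm, ← neg_smul]
  congr 1
  rcases mul_neg_iff.1 (h₁.edgeFn_mul_neg h₂ hdisj) with ⟨ha, hb⟩ | ⟨ha, hb⟩
  · rw [Real.sign_of_pos ha, Real.sign_of_neg hb]
  · rw [Real.sign_of_neg ha, Real.sign_of_pos hb, neg_neg]

/-- Half the absolute value of the determinant of two sides of the triangle. -/
def detArea (t : Tri) : ℝ := |edgeFn (t.vtx 0, t.vtx 1) (t.vtx 2)| / 2

theorem detArea_pos (t : Tri) : 0 < t.detArea :=
  half_pos (abs_pos.2 (t.edgeFn_vtx_ne_zero (by decide) (by decide) (by decide)))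

theorem detArea_mul_inner_gradA (t : Tri) (w : E2) (p : E2 →ᵃ[ℝ] ℝ) :
    t.detArea * ⟪w, gradA p⟫ =
      ⟪w, t.scaledNrm (t.vtx 0, t.vtx 1)⟫ * p (emid (t.vtx 0, t.vtx 1))
        + ⟪w, t.scaledNrm (t.vtx 1, t.vtx 2)⟫ * p (emid (t.vtx 1, t.vtx 2))
        + ⟪w, t.scaledNrm (t.vtx 2, t.vtx 0)⟫ * p (emid (t.vtx 2, t.vtx 0)) := by
  set d := edgeFn (t.vtx 0, t.vtx 1) (t.vtx 2) with hd
  have hd1 : edgeFn (t.vtx 1, t.vtx 2) (t.vtx 0) = d := by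
    simp [hd, edgeFn, perp, emid, midpoint_eq_smul_add, PiLp.inner_apply, Fin.sum_univ_two]
    ring
  have hd2 : edgeFn (t.vtx 2, t.vtx 0) (t.vtx 1) = d := by
    simp [hd, edgeFn, perp, emid, midpoint_eq_smul_add, PiLp.inner_apply, Fin.sum_univ_two]
    ring
  have hsign : Real.sign (d / 3) = Real.sign d := by
    simp only [Real.sign, div_lt_iff₀, lt_div_iff₀, zero_lt_three, zero_mul]
  have habs : |d| = Real.sign d * d := by
    rcases lt_trichotomy d 0 with h | h | h
    · rw [Real.sign_of_neg h, abs_of_neg h, neg_one_mul]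
    · rw [h, abs_zero, mul_zero]
    · rw [Real.sign_of_pos h, abs_of_pos h, one_mul]
  have hp1 := apply_eq_add_inner_gradA p (t.vtx 1) (t.vtx 0)
  have hp2 := apply_eq_add_inner_gradA p (t.vtx 2) (t.vtx 0)
  rw [detArea, ← hd, habs, scaledNrm, scaledNrm, scaledNrm,
    t.edgeFn_centroid (k := 2) (by decide) (by decide) (by decide),
    t.edgeFn_centroid (k := 0) (by decide) (by decide) (by decide),
    t.edgeFn_centroid (k := 1) (by decide) (by decide) (by decide), hd1, hd2, ← hd, hsign,
    affineMap_emid, affineMap_emid, affineMap_emid, hp1, hp2, hd]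
  simp [edgeFn, perp, emid, midpoint_eq_smul_add, PiLp.inner_apply, Fin.sum_univ_two]
  ring

end Tri

namespace Mesh

variable {Ω : Set E2} (M : Mesh Ω)

theorem eq_of_mem_edges {σ τ : E2 × E2} (hσ : σ ∈ M.edges) (hτ : τ ∈ M.edges)
    (h : σ = τ ∨ σ = τ.swap) : σ = τ :=
  h.resolve_right fun h => M.edges_orient τ hτ (h ▸ hσ)

theorem exists_mem_edges {t : Tri} (ht : t ∈ M.tris) {σ : E2 × E2} (h : t.hasEdge σ) :
    ∃ τ ∈ M.edges, τ = σ ∨ τ = σ.swap := by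
  obtain ⟨i, j, k, hij, -, -, rfl⟩ := h.exists_vtx
  rcases M.edges_cover t ht i j hij with h | h
  · exact ⟨_, h, Or.inl rfl⟩
  · exact ⟨_, h, Or.inr rfl⟩

theorem sum_edges_hasEdge {t : Tri} (ht : t ∈ M.tris) (F : E2 × E2 → ℝ)
    (hF : ∀ σ, F σ.swap = F σ) :
    ∑ σ ∈ M.edges.filter fun σ => t.hasEdge σ, F σ =
      F (t.vtx 0, t.vtx 1) + F (t.vtx 1, t.vtx 2) + F (t.vtx 2, t.vtx 0) := by
  have hinj : ∀ i j, t.vtx i = t.vtx j ↔ i = j := fun i j => t.vtx_injective.eq_iff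
  have hedge : ∀ i j : Fin 3, i ≠ j → ∃ e ∈ M.edges, t.hasEdge e ∧ F e = F (t.vtx i, t.vtx j) ∧
      (e = (t.vtx i, t.vtx j) ∨ e = (t.vtx j, t.vtx i)) := by
    intro i j hij
    have h : t.hasEdge (t.vtx i, t.vtx j) :=
      ⟨fun h => hij (t.vtx_injective h), ⟨i, rfl⟩, ⟨j, rfl⟩⟩
    obtain ⟨e, he, rfl | rfl⟩ := M.exists_mem_edges ht h
    · exact ⟨_, he, h, rfl, Or.inl rfl⟩
    · exact ⟨_, he, (t.hasEdge_swap _).2 h, hF _, Or.inr rfl⟩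
  obtain ⟨e, he, hte, hFe, hve⟩ := hedge 0 1 (by simp)
  obtain ⟨f, hf, htf, hFf, hvf⟩ := hedge 1 2 (by simp)
  obtain ⟨g, hg, htg, hFg, hvg⟩ := hedge 2 0 (by simp)
  have hef : e ≠ f := by
    rcases hve with rfl | rfl <;> rcases hvf with rfl | rfl <;> simp [hinj]
  have heg : e ≠ g := by
    rcases hve with rfl | rfl <;> rcases hvg with rfl | rfl <;> simp [hinj]
  have hfg : f ≠ g := by
    rcases hvf with rfl | rfl <;> rcases hvg with rfl | rfl <;> simp [hinj]
  have hset : (M.edges.filter fun σ => t.hasEdge σ) = {e, f, g} := by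
    ext σ
    simp only [Finset.mem_filter, Finset.mem_insert, Finset.mem_singleton]
    refine ⟨fun ⟨hσ, htσ⟩ => ?_, ?_⟩
    · have hcases : (σ = e ∨ σ = e.swap) ∨ (σ = f ∨ σ = f.swap) ∨ (σ = g ∨ σ = g.swap) := by
        obtain ⟨i, j, k, hij, -, -, rfl⟩ := htσ.exists_vtx
        rcases hve with rfl | rfl <;> rcases hvf with rfl | rfl <;> rcases hvg with rfl | rfl <;>
          simp only [Prod.swap_prod_mk, Prod.mk.injEq, hinj] <;> omega
      exact hcases.imp (M.eq_of_mem_edges hσ he)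
        (Or.imp (M.eq_of_mem_edges hσ hf) (M.eq_of_mem_edges hσ hg))
    · rintro (rfl | rfl | rfl)
      exacts [⟨he, hte⟩, ⟨hf, htf⟩, ⟨hg, htg⟩]
  rw [hset, Finset.sum_insert (by simp [hef, heg]), Finset.sum_insert (by simp [hfg]),
    Finset.sum_singleton, hFe, hFf, hFg, add_assoc]

theorem tris_hasEdge_eq_pair {σ : E2 × E2} (hσ : σ ∈ M.edges)
    (h : (M.tris.filter fun t => t.hasEdge σ).card = 2) :
    (M.tris.filter fun t => t.hasEdge σ) = {M.Kof σ, M.Lof σ} := by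
  obtain ⟨hK, hKσ⟩ := M.Kof_mem σ hσ
  obtain ⟨hL, hLσ, hne⟩ := M.Lof_mem σ hσ h
  refine (Finset.eq_of_subset_of_card_le ?_ ?_).symm
  · simp [Finset.insert_subset_iff, hK, hKσ, hL, hLσ]
  · rw [h, Finset.card_pair hne.symm]

theorem tris_hasEdge_eq_singleton {σ : E2 × E2} (hσ : σ ∈ M.edges)
    (h : (M.tris.filter fun t => t.hasEdge σ).card ≠ 2) :
    (M.tris.filter fun t => t.hasEdge σ) = {M.Kof σ} := by
  obtain ⟨hK, hKσ⟩ := M.Kof_mem σ hσ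
  have := M.edges_atMostTwo σ hσ
  refine (Finset.eq_of_subset_of_card_le ?_ ?_).symm
  · simp [hK, hKσ]
  · rw [Finset.card_singleton]
    omega

/-- A property of triangles which is preserved across interior edges and holds for one triangle
holds for all triangles of the mesh. -/
theorem forall_mem_tris_of_adjacent (hΩo : IsOpen Ω) (hΩc : IsPreconnected Ω) (P : Tri → Prop)
    (hP : ∀ σ ∈ M.intEdges, (P (M.Kof σ) ↔ P (M.Lof σ))) {t₀ : Tri} (ht₀ : t₀ ∈ M.tris)
    (h₀ : P t₀) : ∀ t ∈ M.tris, P t := by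
  intro t₁ ht₁
  by_contra h₁
  let F : Set E2 := ⋃ t ∈ (M.tris : Set Tri), Set.range t.vtx
  have hF : F.Countable :=
    (M.tris.finite_toSet.biUnion fun t _ => Set.finite_range t.vtx).countable
  let A : (Tri → Prop) → Set E2 := fun Q => ⋃ t ∈ (M.tris.filter Q : Set Tri), t.carrier
  have hAclosed : ∀ Q, IsClosed (A Q) := fun Q =>
    (M.tris.filter Q).finite_toSet.isClosed_biUnion fun t _ => t.isCompact_carrier.isClosed
  have hAmem : ∀ Q x, x ∈ A Q ↔ ∃ t ∈ M.tris, Q t ∧ x ∈ t.carrier := fun Q x => by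
    simp [A, and_assoc]
  have hmem : ∀ x, x ∈ closure Ω ↔ ∃ t ∈ M.tris, x ∈ t.carrier := fun x => by
    simp [← M.union_eq]
  have hAnonempty : ∀ Q, ∀ t ∈ M.tris, Q t → (Ω \ F ∩ A Q).Nonempty := by
    intro Q t ht hQ
    have hcl : t.centroid ∈ closure Ω :=
      (hmem _).2 ⟨t, ht, interior_subset t.centroid_mem_interior⟩
    obtain ⟨y, hyt, hyΩ⟩ := mem_closure_iff.1 hcl _ isOpen_interior t.centroid_mem_interior
    obtain ⟨z, ⟨hzt, hzΩ⟩, hzF⟩ := (hF.dense_compl ℝ).inter_open_nonempty _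
      (isOpen_interior.inter hΩo) ⟨y, hyt, hyΩ⟩
    exact ⟨z, ⟨hzΩ, hzF⟩, (hAmem _ _).2 ⟨t, ht, hQ, interior_subset hzt⟩⟩
  have hrank : 1 < Module.rank ℝ E2 := Module.one_lt_rank_of_one_lt_finrank (by simp)
  have hconn := isPreconnected_closed_iff.1 (hΩo.isPreconnected_diff_countable hrank hΩc hF)
  obtain ⟨x, ⟨-, hxF⟩, hxA, hxB⟩ := hconn (A P) (A fun t => ¬ P t) (hAclosed _) (hAclosed _)
    (fun x hx => by
      obtain ⟨t, ht, hxt⟩ := (hmem x).1 (subset_closure hx.1)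
      by_cases hPt : P t
      · exact Or.inl ((hAmem _ _).2 ⟨t, ht, hPt, hxt⟩)
      · exact Or.inr ((hAmem _ _).2 ⟨t, ht, hPt, hxt⟩))
    (hAnonempty _ t₀ ht₀ h₀) (hAnonempty _ t₁ ht₁ h₁)
  obtain ⟨t, ht, hPt, hxt⟩ := (hAmem _ _).1 hxA
  obtain ⟨t', ht', hPt', hxt'⟩ := (hAmem _ _).1 hxB
  have hne : t ≠ t' := fun h => hPt' (h ▸ hPt)
  have hx : x ∈ t.carrier ∩ t'.carrier := ⟨hxt, hxt'⟩
  rcases M.inter_structure t ht t' ht' hne with h | ⟨a, ⟨ha, -⟩, h⟩ | ⟨σ, hσ, hσ', -⟩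
  · exact Set.eq_empty_iff_forall_notMem.1 h x hx
  · rw [h, Set.mem_singleton_iff] at hx
    exact hxF (Set.mem_biUnion ht (hx ▸ ha))
  · obtain ⟨τ, hτ, hτσ⟩ := M.exists_mem_edges ht hσ
    have hmemτ : ∀ s ∈ M.tris, s.hasEdge σ → s ∈ M.tris.filter fun t => t.hasEdge τ := by
      intro s hs hsσ
      refine Finset.mem_filter.2 ⟨hs, ?_⟩
      rcases hτσ with rfl | rfl
      exacts [hsσ, (s.hasEdge_swap σ).2 hsσ]
    have hcard : (M.tris.filter fun t => t.hasEdge τ).card = 2 :=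
      le_antisymm (M.edges_atMostTwo τ hτ)
        (Finset.one_lt_card.2 ⟨t, hmemτ t ht hσ, t', hmemτ t' ht' hσ', hne⟩)
    have hiff := hP τ (Finset.mem_filter.2 ⟨hτ, hcard⟩)
    have h1 := hmemτ t ht hσ
    have h2 := hmemτ t' ht' hσ'
    rw [M.tris_hasEdge_eq_pair hτ hcard, Finset.mem_insert, Finset.mem_singleton] at h1 h2
    rcases h1 with rfl | rfl <;> rcases h2 with rfl | rfl <;> tauto

/-- The functions of `P₁^{nc}` dual to the values at the midpoints of the edges. -/
theorem exists_midpoint_basis {σ₀ : E2 × E2} (hσ₀ : σ₀ ∈ M.edges) :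
    ∃ p : Tri → (E2 →ᵃ[ℝ] ℝ), ∀ t, ∀ σ ∈ M.edges, t.hasEdge σ →
      p t (emid σ) = if σ = σ₀ then 1 else 0 := by
  suffices h : ∀ t : Tri, ∃ f : E2 →ᵃ[ℝ] ℝ, ∀ σ ∈ M.edges, t.hasEdge σ →
      f (emid σ) = if σ = σ₀ then 1 else 0 by
    choose p hp using h
    exact ⟨p, hp⟩
  intro t
  by_cases ht : t.hasEdge σ₀
  · obtain ⟨i, j, k, hij, hik, hjk, rfl⟩ := ht.exists_vtx
    obtain ⟨f, hf⟩ := t.exists_affineMap_vtx_eq fun l => if l = k then -1 else 1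
    refine ⟨f, fun σ hσ htσ => ?_⟩
    obtain ⟨a, b, -, hab, -, -, rfl⟩ := htσ.exists_vtx
    have hiff : (t.vtx a, t.vtx b) = (t.vtx i, t.vtx j) ↔ a ≠ k ∧ b ≠ k := by
      refine ⟨fun h => ?_, fun h => M.eq_of_mem_edges hσ hσ₀ ?_⟩
      · simp only [Prod.mk.injEq, t.vtx_injective.eq_iff] at h
        omega
      · simp only [Prod.swap_prod_mk, Prod.mk.injEq, t.vtx_injective.eq_iff]
        omega
    rw [affineMap_emid, hf, hf]
    simp only [hiff]
    by_cases ha : a = k <;> by_cases hb : b = k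
    · omega
    all_goals simp [ha, hb]
  · refine ⟨0, fun σ _ htσ => ?_⟩
    rw [if_neg fun h : σ = σ₀ => ht (h ▸ htσ)]
    rfl

theorem divhImage_sub_smul (u v : Tri → E2) (c : ℝ) (σ : E2 × E2) :
    M.divhImage (fun t => u t - c • v t) σ = M.divhImage u σ - c * M.divhImage v σ := by
  simp only [divhImage, inner_sub_left, inner_smul_left, RCLike.conj_to_real]
  split_ifs <;> ring

/-- The area attached to an edge: one third of the total area of the adjacent triangles. -/
def edgeArea (σ : E2 × E2) : ℝ :=
  if (M.tris.filter fun t => t.hasEdge σ).card = 2 then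
    ((M.Kof σ).area + (M.Lof σ).area) / 3
  else (M.Kof σ).area / 3

theorem edgeArea_pos (σ : E2 × E2) : 0 < M.edgeArea σ := by
  have := (M.Kof σ).area_pos
  have := (M.Lof σ).area_pos
  unfold edgeArea
  split_ifs <;> positivity

/-- Discrete integration by parts. -/
theorem sum_detArea_mul_inner_gradh (w : Tri → E2) {p : Tri → (E2 →ᵃ[ℝ] ℝ)} (hp : M.IsP1nc p) :
    ∑ t ∈ M.tris, t.detArea * ⟪w t, gradh p t⟫ =
      -∑ σ ∈ M.edges, M.edgeArea σ * M.divhImage w σ * p (M.Kof σ) (emid σ) := by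
  have htri : ∀ t ∈ M.tris, t.detArea * ⟪w t, gradh p t⟫ =
      ∑ σ ∈ M.edges.filter fun σ => t.hasEdge σ, ⟪w t, t.scaledNrm σ⟫ * p t (emid σ) := by
    intro t ht
    rw [M.sum_edges_hasEdge ht _ fun σ => by rw [t.scaledNrm_swap, emid_swap]]
    exact t.detArea_mul_inner_gradA (w t) (p t)
  rw [Finset.sum_congr rfl htri, Finset.sum_comm' (t' := M.edges)
    (s' := fun σ => M.tris.filter fun t => t.hasEdge σ)
    (by simp only [Finset.mem_filter]; tauto), ← Finset.sum_neg_distrib]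
  refine Finset.sum_congr rfl fun σ hσ => ?_
  obtain ⟨hK, hKσ⟩ := M.Kof_mem σ hσ
  have hKpos := (M.Kof σ).area_pos
  have hLpos := (M.Lof σ).area_pos
  unfold edgeArea divhImage
  split_ifs with h
  · obtain ⟨hL, hLσ, hne⟩ := M.Lof_mem σ hσ h
    have hopp := hKσ.scaledNrm_eq_neg hLσ (M.interior_disjoint _ hK _ hL hne.symm)
    rw [M.tris_hasEdge_eq_pair hσ h, Finset.sum_pair hne.symm, hopp,
      ← hp σ (Finset.mem_filter.2 ⟨hσ, h⟩), ← hKσ.elen_smul_nrm]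
    simp only [inner_neg_right, inner_smul_right, inner_sub_left]
    field_simp
    ring
  · rw [M.tris_hasEdge_eq_singleton hσ h, Finset.sum_singleton, ← hKσ.elen_smul_nrm]
    simp only [inner_smul_right]
    field_simp

theorem IsP1nc.sub {q r : Tri → (E2 →ᵃ[ℝ] ℝ)} (hq : M.IsP1nc q) (hr : M.IsP1nc r) :
    M.IsP1nc fun t => q t - r t := fun σ hσ => by
  simp [hq σ hσ, hr σ hσ]

theorem MeanZero.sub {q r : Tri → (E2 →ᵃ[ℝ] ℝ)} (hq : M.MeanZero q) (hr : M.MeanZero r) :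
    M.MeanZero fun t => q t - r t := by
  unfold MeanZero at *
  rw [← sub_zero (0 : ℝ)]
  nth_rewrite 1 [← hq]
  rw [← hr, ← Finset.sum_sub_distrib]
  exact Finset.sum_congr rfl fun t _ =>
    integral_sub (t.integrableOn_affineMap (q t)) (t.integrableOn_affineMap (r t))

theorem exists_meanZero_sub_const (q : Tri → (E2 →ᵃ[ℝ] ℝ)) :
    ∃ k : ℝ, M.MeanZero fun t => q t - AffineMap.const ℝ E2 k := by
  have hpos : 0 < ∑ t ∈ M.tris, t.area := Finset.sum_pos (fun t _ => t.area_pos) M.tris_nonempty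
  refine ⟨(∑ t ∈ M.tris, ∫ x in t.carrier, q t x) / ∑ t ∈ M.tris, t.area, ?_⟩
  set k := (∑ t ∈ M.tris, ∫ x in t.carrier, q t x) / ∑ t ∈ M.tris, t.area with hk
  have hint : ∀ t : Tri, ∫ x in t.carrier, (q t - AffineMap.const ℝ E2 k) x
      = (∫ x in t.carrier, q t x) - t.area * k := fun t => by
    rw [← t.setIntegral_const]
    exact integral_sub (t.integrableOn_affineMap (q t))
      (t.integrableOn_affineMap (AffineMap.const ℝ E2 k))
  unfold MeanZero
  rw [Finset.sum_congr rfl fun t _ => hint t, Finset.sum_sub_distrib, ← Finset.sum_mul, hk,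
    mul_div_cancel₀ _ hpos.ne', sub_self]

theorem eq_zero_of_divhImage_gradh_eq_zero (hΩo : IsOpen Ω) (hΩc : IsPreconnected Ω)
    {q : Tri → (E2 →ᵃ[ℝ] ℝ)} (hq : M.IsP1nc q) (hmean : M.MeanZero q)
    (hdiv : ∀ σ ∈ M.edges, M.divhImage (gradh q) σ = 0) : ∀ t ∈ M.tris, q t = 0 := by
  have hsum : ∑ t ∈ M.tris, t.detArea * ⟪gradh q t, gradh q t⟫ = 0 := by
    rw [M.sum_detArea_mul_inner_gradh _ hq, neg_eq_zero]
    exact Finset.sum_eq_zero fun σ hσ => by rw [hdiv σ hσ, mul_zero, zero_mul]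
  have hgrad : ∀ t ∈ M.tris, gradA (q t) = 0 := by
    intro t ht
    have := (Finset.sum_eq_zero_iff_of_nonneg fun t _ =>
      mul_nonneg t.detArea_pos.le real_inner_self_nonneg).1 hsum t ht
    exact inner_self_eq_zero.1 ((mul_eq_zero.1 this).resolve_left t.detArea_pos.ne')
  have hconst : ∀ t ∈ M.tris, ∀ x y, q t x = q t y := fun t ht x y => by
    rw [apply_eq_add_inner_gradA (q t) x y, hgrad t ht, inner_zero_left, add_zero]
  obtain ⟨t₀, ht₀⟩ := M.tris_nonempty
  have hall := M.forall_mem_tris_of_adjacent hΩo hΩc (fun t => q t 0 = q t₀ 0) (fun σ hσ => by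
    obtain ⟨hσe, hcard⟩ := Finset.mem_filter.1 hσ
    have h := hq σ hσ
    rw [hconst _ (M.Kof_mem σ hσe).1 _ 0, hconst _ (M.Lof_mem σ hσe hcard).1 _ 0] at h
    rw [h]) ht₀ rfl
  have hval : ∀ t ∈ M.tris, ∀ x, q t x = q t₀ 0 := fun t ht x =>
    (hconst t ht x 0).trans (hall t ht)
  have hpos : 0 < ∑ t ∈ M.tris, t.area := Finset.sum_pos (fun t _ => t.area_pos) M.tris_nonempty
  have hzero : (∑ t ∈ M.tris, t.area) * q t₀ 0 = 0 := by
    rw [← show _ = (0 : ℝ) from hmean, Finset.sum_mul]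
    refine Finset.sum_congr rfl fun t ht => ?_
    simp only [hval t ht, t.setIntegral_const]
  intro t ht
  ext x
  rw [hval t ht x, (mul_eq_zero.1 hzero).resolve_left hpos.ne']
  rfl

/-- The weighted projection of a `P₀` field onto the gradients of `P₁^{nc}`. -/
theorem exists_isP1nc_forall_sum_eq_zero (v : Tri → E2) :
    ∃ q : Tri → (E2 →ᵃ[ℝ] ℝ), M.IsP1nc q ∧ ∀ p : Tri → (E2 →ᵃ[ℝ] ℝ), M.IsP1nc p →
      ∑ t ∈ M.tris, t.detArea * ⟪gradh q t - v t, gradh p t⟫ = 0 := by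
  let W : Submodule ℝ (Tri → (E2 →ᵃ[ℝ] ℝ)) :=
    { carrier := {q | M.IsP1nc q}
      add_mem' := fun {q r} hq hr σ hσ => by simp [hq σ hσ, hr σ hσ]
      zero_mem' := fun σ hσ => rfl
      smul_mem' := fun a q hq σ hσ => by simp [hq σ hσ] }
  let scale : (Tri → E2) → PiLp 2 fun _ : M.tris => E2 := fun u =>
    WithLp.toLp 2 fun t => Real.sqrt (t : Tri).detArea • u t
  let G : (Tri → (E2 →ᵃ[ℝ] ℝ)) →ₗ[ℝ] PiLp 2 fun _ : M.tris => E2 :=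
    { toFun := fun q => scale fun t => gradAₗ (q t)
      map_add' := fun q r => by
        ext t : 1
        simp [scale]
      map_smul' := fun a q => by
        ext t : 1
        simp [scale, smul_comm a] }
  let S := W.map G
  obtain ⟨q, hq, hGq⟩ := Submodule.mem_map.1 (S.starProjection_apply_mem (scale v))
  refine ⟨q, hq, fun p hp => ?_⟩
  have horth := S.sub_starProjection_mem_orthogonal (scale v) (G p) (Submodule.mem_map_of_mem hp)
  rw [← hGq, PiLp.inner_apply] at horth
  rw [← Finset.sum_coe_sort, ← neg_eq_zero, ← horth, ← Finset.sum_neg_distrib]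
  refine Finset.sum_congr rfl fun t _ => ?_
  change _ = ⟪Real.sqrt (t : Tri).detArea • gradh p t,
    Real.sqrt (t : Tri).detArea • v t - Real.sqrt (t : Tri).detArea • gradh q t⟫
  rw [← smul_sub, real_inner_smul_left, real_inner_smul_right, ← mul_assoc,
    Real.mul_self_sqrt (t : Tri).detArea_pos.le, real_inner_comm, ← neg_sub (gradh q t),
    inner_neg_right, mul_neg, real_inner_comm]

theorem exists_isP1nc_divhImage_gradh_eq (v : Tri → E2) (c : ℝ) :
    ∃ q : Tri → (E2 →ᵃ[ℝ] ℝ), M.IsP1nc q ∧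
      ∀ σ ∈ M.edges, M.divhImage (gradh q) σ = c * M.divhImage v σ := by
  obtain ⟨q, hq, horth⟩ := M.exists_isP1nc_forall_sum_eq_zero fun t => c • v t
  refine ⟨q, hq, fun σ₀ hσ₀ => ?_⟩
  obtain ⟨p, hp⟩ := M.exists_midpoint_basis hσ₀
  have hpnc : M.IsP1nc p := fun σ hσ => by
    obtain ⟨hσe, hcard⟩ := Finset.mem_filter.1 hσ
    rw [hp _ σ hσe (M.Kof_mem σ hσe).2, hp _ σ hσe (M.Lof_mem σ hσe hcard).2.1]
  have hsum := horth p hpnc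
  rw [M.sum_detArea_mul_inner_gradh (fun t => gradh q t - c • v t) hpnc, neg_eq_zero,
    Finset.sum_congr rfl fun σ hσ => by rw [hp _ σ hσ (M.Kof_mem σ hσ).2]] at hsum
  simp only [mul_ite, mul_one, mul_zero, Finset.sum_ite_eq', hσ₀, if_true, mul_eq_zero,
    (M.edgeArea_pos σ₀).ne', false_or] at hsum
  rwa [M.divhImage_sub_smul, sub_eq_zero] at hsum

end Mesh

/-- **Existence and uniqueness for the discrete Poisson problem**: for every `v_h ∈ P₀`
and every `c ∈ ℝ` there exists a unique `q_h ∈ P₁^{nc} ∩ L²₀` with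
`div_h(∇_h q_h) = c · div_h v_h` (equality in `P₁^{nc}`, i.e. equality of the values at
all edge midpoints).  In particular the only `q_h ∈ P₁^{nc} ∩ L²₀` with
`div_h(∇_h q_h) = 0` is `q_h = 0`. -/
theorem discrete_poisson_existence_uniqueness
    {Ω : Set E2} (hΩo : IsOpen Ω) (hΩc : IsConnected Ω) (hΩb : Bornology.IsBounded Ω)
    (M : Mesh Ω) (v : Tri → E2) (c : ℝ) :
    (∃ q : Tri → (E2 →ᵃ[ℝ] ℝ),
      (M.IsP1nc q ∧ M.MeanZero q ∧
        ∀ σ ∈ M.edges, M.divhImage (gradh q) σ = c * M.divhImage v σ) ∧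
      ∀ q' : Tri → (E2 →ᵃ[ℝ] ℝ),
        (M.IsP1nc q' ∧ M.MeanZero q' ∧
          ∀ σ ∈ M.edges, M.divhImage (gradh q') σ = c * M.divhImage v σ) →
        ∀ t ∈ M.tris, q' t = q t)
    ∧ (∀ q : Tri → (E2 →ᵃ[ℝ] ℝ), M.IsP1nc q → M.MeanZero q →
        (∀ σ ∈ M.edges, M.divhImage (gradh q) σ = 0) → ∀ t ∈ M.tris, q t = 0) := by
  have hzero : ∀ q : Tri → (E2 →ᵃ[ℝ] ℝ), M.IsP1nc q → M.MeanZero q →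
      (∀ σ ∈ M.edges, M.divhImage (gradh q) σ = 0) → ∀ t ∈ M.tris, q t = 0 := fun q =>
    M.eq_zero_of_divhImage_gradh_eq_zero hΩo hΩc.isPreconnected
  refine ⟨?_, hzero⟩
  obtain ⟨q, hq, hdiv⟩ := M.exists_isP1nc_divhImage_gradh_eq v c
  obtain ⟨k, hk⟩ := M.exists_meanZero_sub_const q
  have hgrad : gradh (fun t => q t - AffineMap.const ℝ E2 k) = gradh q :=
    funext fun t => by rw [gradh, gradA_sub, gradA_const, sub_zero, gradh]
  have hqk : M.IsP1nc fun t => q t - AffineMap.const ℝ E2 k := fun σ hσ => by simp [hq σ hσ]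
  refine ⟨fun t => q t - AffineMap.const ℝ E2 k, ⟨hqk, hk, by rwa [hgrad]⟩, ?_⟩
  rintro q' ⟨hq', hmean', hdiv'⟩ t ht
  have hsub : gradh (fun t => q' t - (q t - AffineMap.const ℝ E2 k))
      = fun t => gradh q' t - (1 : ℝ) • gradh q t := by
    rw [← hgrad]
    exact funext fun t => by rw [one_smul, gradh, gradA_sub, gradh, gradh]
  refine sub_eq_zero.1 (hzero _ (hq'.sub M hqk) (hmean'.sub M hk) (fun σ hσ => ?_) t ht)
  rw [hsub, M.divhImage_sub_smul, hdiv' σ hσ, hdiv σ hσ, one_mul, sub_self]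

end
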